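/- Let $(S_n)_{n \ge 0}$ be the locally perturbed simple random walk on $\mathbb{Z}^2$: a Markov chain with $S_0 = (0,0)$ whose transition probabilities satisfy $P(S_{n+1} = S_n \pm e_i \mid S_n) = 1/4$ for $i = 1,2$ whenever $S_n \neq (0,0)$, while from the origin the chain jumps to one of the four neighbours $\pm e_1, \pm e_2$ with fixed strictly positive probabilities $p_1, p_2, p_3, p_4$ summing to $1$. Then the local central limit theorem holds at the origin: $\lim_{n \to \infty} n \, P(S_{2n} = (0,0)) = 1/\pi$, the same limit as for the unperturbed simple symmetric random walk on $\mathbb{Z}^2$. -/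

import Mathlib

open MeasureTheory ProbabilityTheory Filter
open scoped NNReal ENNReal Topology

/-- The four signed standard unit vectors of `ℤ²`. -/
def nbrs : Finset (ℤ × ℤ) := {(1, 0), (-1, 0), (0, 1), (0, -1)}

/-- The cylinder event that the trajectory `S` follows the history `h` up to time `n`. -/
def prefixEvent {Ω : Type*} (S : ℕ → Ω → ℤ × ℤ) (n : ℕ) (h : ℕ → ℤ × ℤ) : Set Ω :=
  {ω | ∀ k ≤ n, S k ω = h k}

/-- The law at time `n` of the simple symmetric random walk on `ℤ` started at `0`. -/
noncomputable def lineWalkLaw : ℕ → ℤ → ℝ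
  | 0, a => if a = 0 then 1 else 0
  | n + 1, a => (lineWalkLaw n (a - 1) + lineWalkLaw n (a + 1)) / 2

theorem lineWalkLaw_eq_zero_of_lt (n : ℕ) : ∀ a : ℤ, a < -n → lineWalkLaw n a = 0 := by
  induction n with
  | zero => intro a ha; simp only [lineWalkLaw]; rw [if_neg]; push_cast at ha; omega
  | succ n ih =>
    intro a ha
    push_cast at ha
    simp only [lineWalkLaw]
    rw [ih _ (by omega), ih _ (by omega)]
    simp

theorem lineWalkLaw_eq_choose (n : ℕ) :
    ∀ k : ℕ, lineWalkLaw n (2 * k - n) = n.choose k / 2 ^ n := by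
  induction n with
  | zero =>
    intro k
    cases k with
    | zero => simp [lineWalkLaw]
    | succ k =>
      simp only [lineWalkLaw]
      rw [if_neg (by push_cast; omega)]
      simp
  | succ n ih =>
    intro k
    have h2 : lineWalkLaw n (2 * k - (n + 1 : ℕ) + 1) = n.choose k / 2 ^ n := by
      rw [← ih k]; congr 1; push_cast; ring
    simp only [lineWalkLaw]
    rw [h2]
    cases k with
    | zero =>
      rw [lineWalkLaw_eq_zero_of_lt n _ (by push_cast; omega)]
      simp only [Nat.choose_zero_right]
      field_simp
      ring
    | succ k =>
      have h1 : lineWalkLaw n (2 * (k + 1 : ℕ) - (n + 1 : ℕ) - 1) = n.choose k / 2 ^ n := by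
        rw [← ih k]; congr 1; push_cast; ring
      rw [h1, Nat.choose_succ_succ]
      push_cast
      field_simp
      ring

theorem lineWalkLaw_two_mul_zero (n : ℕ) :
    lineWalkLaw (2 * n) 0 = n.centralBinom / 4 ^ n := by
  have h := lineWalkLaw_eq_choose (2 * n) n
  rw [show (2 * (n : ℤ) - (2 * n : ℕ)) = 0 by push_cast; ring, pow_mul] at h
  rw [h, Nat.centralBinom]
  norm_num

theorem tendsto_mul_centralBinom_div_sq :
    Tendsto (fun n : ℕ => (n : ℝ) * ((n.centralBinom : ℝ) / 4 ^ n) ^ 2) atTop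
      (𝓝 (1 / Real.pi)) := by
  have hW := Real.Wallis.tendsto_W_nhds_pi_div_two
  have hr : Tendsto (fun n : ℕ => (n : ℝ) / (2 * n + 1)) atTop (𝓝 (1 / 2)) := by
    have h := (tendsto_natCast_div_add_atTop (1 / 2 : ℝ)).div_const 2
    refine h.congr fun n => ?_
    have : (0 : ℝ) ≤ n := n.cast_nonneg
    field_simp
  have h := hr.div hW (by positivity)
  rw [show (1 / 2 : ℝ) / (Real.pi / 2) = 1 / Real.pi by field_simp] at h
  refine h.congr fun n => ?_
  have hc : ((2 * n).factorial : ℝ) = n.centralBinom * n.factorial ^ 2 := by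
    have := Nat.choose_mul_factorial_mul_factorial (show n ≤ 2 * n by omega)
    rw [show 2 * n - n = n by omega] at this
    rw [← this, Nat.centralBinom]
    push_cast
    ring
  have hf : (n.factorial : ℝ) ≠ 0 := by positivity
  have hb : (n.centralBinom : ℝ) ≠ 0 := by exact_mod_cast n.centralBinom_ne_zero
  simp only [Pi.div_apply]
  rw [Real.Wallis.W_eq_factorial_ratio, hc, show (2 : ℝ) ^ (4 * n) = (4 ^ n) ^ 2 by
    rw [← pow_mul, show (4 : ℝ) = 2 ^ 2 by norm_num, ← pow_mul]; ring_nf]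
  have : (2 * (n : ℝ) + 1) ≠ 0 := by positivity
  field_simp

/-- The deviation from `1/4` of the jump law `p` from the origin. -/
noncomputable def originDefect (p : ℤ × ℤ → ℝ) (y : ℤ × ℤ) : ℝ :=
  if y ∈ nbrs then p y - 1 / 4 else 0

theorem sum_nbrs {M : Type*} [AddCommMonoid M] (f : ℤ × ℤ → M) :
    ∑ v ∈ nbrs, f v = f (1, 0) + (f (-1, 0) + (f (0, 1) + f (0, -1))) := by
  simp [nbrs]

theorem mem_nbrs {y : ℤ × ℤ} :
    y ∈ nbrs ↔ y = (1, 0) ∨ y = (-1, 0) ∨ y = (0, 1) ∨ y = (0, -1) := by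
  simp [nbrs]

theorem originDefect_rotation_sum {p : ℤ × ℤ → ℝ} (hp : ∑ v ∈ nbrs, p v = 1) (a b : ℤ) :
    originDefect p (a, b) + originDefect p (-b, a) + originDefect p (-a, -b)
      + originDefect p (b, -a) = 0 := by
  rw [sum_nbrs] at hp
  by_cases h : (a, b) ∈ nbrs
  · rcases mem_nbrs.1 h with h | h | h | h <;> obtain ⟨rfl, rfl⟩ := Prod.mk.inj h <;>
      simp [originDefect, nbrs] <;> linarith
  · have h1 : (-b, a) ∉ nbrs := by simp only [mem_nbrs, Prod.mk.injEq] at h ⊢; omega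
    have h2 : (-a, -b) ∉ nbrs := by simp only [mem_nbrs, Prod.mk.injEq] at h ⊢; omega
    have h3 : (b, -a) ∉ nbrs := by simp only [mem_nbrs, Prod.mk.injEq] at h ⊢; omega
    simp [originDefect, h, h1, h2, h3]

/-- The average of the law of the perturbed walk over the rotations by multiples of `π/2` is the
law of the unperturbed walk, which factorizes in the coordinates `a + b`, `a - b`. -/
theorem rotation_average_eq {m : ℕ → ℤ × ℤ → ℝ} {p : ℤ × ℤ → ℝ} (hp : ∑ v ∈ nbrs, p v = 1)
    (h0 : ∀ y, m 0 y = if y = (0, 0) then 1 else 0)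
    (hm : ∀ n y, m (n + 1) y
      = 1 / 4 * ∑ v ∈ nbrs, m n (y - v) + originDefect p y * m n (0, 0)) (n : ℕ) :
    ∀ a b : ℤ, (m n (a, b) + m n (-b, a) + m n (-a, -b) + m n (b, -a)) / 4
      = lineWalkLaw n (a + b) * lineWalkLaw n (a - b) := by
  induction n with
  | zero =>
    intro a b
    by_cases h : a = 0 ∧ b = 0
    · obtain ⟨rfl, rfl⟩ := h
      simp [h0, lineWalkLaw]
      norm_num
    · have hab : a + b ≠ 0 ∨ a - b ≠ 0 := by omega
      have hR : lineWalkLaw 0 (a + b) * lineWalkLaw 0 (a - b) = 0 := by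
        rcases hab with h | h <;> simp [lineWalkLaw, h]
      rw [hR]
      simp only [h0, Prod.mk.injEq]
      rw [if_neg (by omega), if_neg (by omega), if_neg (by omega), if_neg (by omega)]
      simp
  | succ n ih =>
    intro a b
    have e1 := ih (a - 1) b
    have e2 := ih (a + 1) b
    have e3 := ih a (b - 1)
    have e4 := ih a (b + 1)
    have hd := originDefect_rotation_sum hp a b
    rw [show a - 1 + b = a + b - 1 by ring, show a - 1 - b = a - b - 1 by ring,
      show -(a - 1) = -a + 1 by ring] at e1
    rw [show a + 1 + b = a + b + 1 by ring, show a + 1 - b = a - b + 1 by ring,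
      show -(a + 1) = -a - 1 by ring] at e2
    rw [show a + (b - 1) = a + b - 1 by ring, show a - (b - 1) = a - b + 1 by ring,
      show -(b - 1) = -b + 1 by ring] at e3
    rw [show a + (b + 1) = a + b + 1 by ring, show a - (b + 1) = a - b - 1 by ring,
      show -(b + 1) = -b - 1 by ring] at e4
    simp only [hm, sum_nbrs, Prod.mk_sub_mk, sub_zero, sub_neg_eq_add, lineWalkLaw]
    linear_combination (e1 + e2 + e3 + e4) / 4 + m n (0, 0) / 4 * hd

section Chain

variable {Ω : Type*} [MeasurableSpace Ω] {P : Measure Ω} {S : ℕ → Ω → ℤ × ℤ}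

/-- The one-step Markov property given the whole history implies the one given the present. -/
theorem measure_step_inter (hmeas : ∀ n, Measurable (S n)) {n : ℕ} {x v : ℤ × ℤ} {c : ℝ≥0∞}
    (hstep : ∀ h : ℕ → ℤ × ℤ, h n = x →
      P ({ω | S (n + 1) ω = h n + v} ∩ prefixEvent S n h) = c * P (prefixEvent S n h)) :
    P ({ω | S (n + 1) ω = x + v} ∩ {ω | S n ω = x}) = c * P {ω | S n ω = x} := by
  let T : Ω → (Fin (n + 1) → ℤ × ℤ) := fun ω k => S k ω
  have hT : Measurable T := measurable_pi_lambda _ fun k => hmeas k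
  let s : Set (Fin (n + 1) → ℤ × ℤ) := {t | t (Fin.last n) = x}
  have hpre : T ⁻¹' s = {ω | S n ω = x} := by
    ext ω; simp [T, s]
  have hA : MeasurableSet {ω | S (n + 1) ω = x + v} :=
    hmeas (n + 1) (measurableSet_singleton (x + v))
  have hfib : ∀ t : s, ∃ h : ℕ → ℤ × ℤ, h n = x ∧ T ⁻¹' {t.1} = prefixEvent S n h := by
    rintro ⟨t, ht⟩
    refine ⟨fun k => if hk : k < n + 1 then t ⟨k, hk⟩ else 0, ?_, ?_⟩
    · simpa [s, Fin.last] using ht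
    · ext ω
      simp only [Set.mem_preimage, Set.mem_singleton_iff, prefixEvent, Set.mem_ofPred_eq]
      constructor
      · intro h k hk
        rw [dif_pos (Nat.lt_succ_of_le hk), ← h]
      · intro h
        funext k
        have := h k (Nat.le_of_lt_succ k.2)
        rwa [dif_pos k.2] at this
  have hs : s.Countable := s.to_countable
  have h1 := tsum_measure_preimage_singleton (μ := P) hs
    (f := T) fun t _ => hT (measurableSet_singleton t)
  have h2 := tsum_measure_preimage_singleton (μ := P.restrict {ω | S (n + 1) ω = x + v}) hs
    (f := T) fun t _ => hT (measurableSet_singleton t)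
  rw [hpre] at h1 h2
  rw [Set.inter_comm, ← Measure.restrict_apply' hA, ← h1, ← h2, ← ENNReal.tsum_mul_left]
  refine tsum_congr fun t => ?_
  obtain ⟨h, hn, ht⟩ := hfib t
  rw [Measure.restrict_apply' hA, ht, Set.inter_comm, ← hstep h hn, hn]

theorem ae_sub_mem_nbrs [IsFiniteMeasure P] (hmeas : ∀ n, Measurable (S n)) {n : ℕ}
    {q : ℤ × ℤ → ℤ × ℤ → ℝ≥0∞} (hq : ∀ x, ∑ v ∈ nbrs, q x v = 1)
    (hstep : ∀ x, ∀ v ∈ nbrs,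
      P ({ω | S (n + 1) ω = x + v} ∩ {ω | S n ω = x}) = q x v * P {ω | S n ω = x}) :
    ∀ᵐ ω ∂P, S (n + 1) ω - S n ω ∈ nbrs := by
  have hms : ∀ k y, MeasurableSet {ω | S k ω = y} := fun k y =>
    hmeas k (measurableSet_singleton y)
  have key : ∀ x, ∀ᵐ ω ∂P, S n ω = x → S (n + 1) ω - x ∈ nbrs := by
    intro x
    let U : Set Ω := ⋃ v ∈ nbrs, {ω | S (n + 1) ω = x + v} ∩ {ω | S n ω = x}
    have hU : P U = P {ω | S n ω = x} := by
      rw [measure_biUnion_finset]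
      · rw [Finset.sum_congr rfl (hstep x), ← Finset.sum_mul, hq, one_mul]
      · intro v _ w _ hvw
        refine Set.disjoint_left.2 fun ω h1 h2 => hvw ?_
        exact add_left_cancel (h1.1.symm.trans h2.1)
      · exact fun v _ => (hms _ _).inter (hms _ _)
    have hUm : MeasurableSet U :=
      nbrs.measurableSet_biUnion fun v _ => (hms _ _).inter (hms _ _)
    have hsub : U ⊆ {ω | S n ω = x} := Set.iUnion₂_subset fun v _ => Set.inter_subset_right
    have hd : P ({ω | S n ω = x} \ U) = 0 := by
      rw [measure_sdiff hsub hUm.nullMeasurableSet (measure_ne_top _ _), hU, tsub_self]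
    refine measure_mono_null (fun ω hω => ?_) hd
    simp only [Set.mem_compl_iff, Set.mem_ofPred_eq, Classical.not_imp] at hω
    refine ⟨hω.1, fun hωU => hω.2 ?_⟩
    obtain ⟨v, hv, h1, -⟩ := Set.mem_iUnion₂.1 hωU
    rw [show S (n + 1) ω = x + v from h1, add_sub_cancel_left]
    exact hv
  filter_upwards [ae_all_iff.2 key] with ω hω using hω _ rfl

theorem measure_succ_eq_sum [IsFiniteMeasure P] (hmeas : ∀ n, Measurable (S n)) {n : ℕ}
    {q : ℤ × ℤ → ℤ × ℤ → ℝ≥0∞} (hq : ∀ x, ∑ v ∈ nbrs, q x v = 1)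
    (hstep : ∀ x, ∀ v ∈ nbrs,
      P ({ω | S (n + 1) ω = x + v} ∩ {ω | S n ω = x}) = q x v * P {ω | S n ω = x})
    (y : ℤ × ℤ) :
    P {ω | S (n + 1) ω = y} = ∑ v ∈ nbrs, q (y - v) v * P {ω | S n ω = y - v} := by
  have hms : ∀ k y, MeasurableSet {ω | S k ω = y} := fun k y =>
    hmeas k (measurableSet_singleton y)
  have hae : {ω | S (n + 1) ω = y} =ᵐ[P]
      ⋃ v ∈ nbrs, {ω | S (n + 1) ω = y - v + v} ∩ {ω | S n ω = y - v} := by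
    filter_upwards [ae_sub_mem_nbrs hmeas hq hstep] with ω hω
    refine propext ⟨fun h => ?_, fun h => ?_⟩
    · have h' : S (n + 1) ω = y := h
      refine Set.mem_iUnion₂.2 ⟨_, hω, ?_, ?_⟩
      · simp [h']
      · simp [h']
    · obtain ⟨v, -, h1, -⟩ := Set.mem_iUnion₂.1 h
      exact h1.trans (sub_add_cancel y v)
  rw [measure_congr hae, measure_biUnion_finset]
  · exact Finset.sum_congr rfl fun v hv => hstep _ v hv
  · intro v _ w _ hvw
    refine Set.disjoint_left.2 fun ω h1 h2 => hvw ?_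
    exact sub_right_injective (h1.2.symm.trans h2.2)
  · exact fun v _ => (hms _ _).inter (hms _ _)

end Chain

/-- **Local CLT for the locally perturbed simple random walk on `ℤ²`.**
`S` is a Markov chain started at the origin which jumps to each of the four
nearest neighbours with probability `1/4` from every non-origin site, and from
the origin jumps to the four neighbours with arbitrary fixed strictly positive
probabilities `p v` summing to `1`.  Then
`n · P(S (2n) = (0,0)) → 1/π` as `n → ∞` — the same limit as for the
unperturbed simple symmetric random walk. -/
theorem locally_perturbed_ssrw_local_clt
    {Ω : Type*} [MeasurableSpace Ω] (P : Measure Ω) [IsProbabilityMeasure P]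
    (S : ℕ → Ω → ℤ × ℤ)
    (hmeas : ∀ n, Measurable (S n))
    (hS0 : ∀ᵐ ω ∂P, S 0 ω = (0, 0))
    (p : ℤ × ℤ → ℝ≥0∞) (hp : ∑ v ∈ nbrs, p v = 1)
    (hppos : ∀ v ∈ nbrs, 0 < p v)
    (hMarkov : ∀ (n : ℕ) (h : ℕ → ℤ × ℤ), h n ≠ (0, 0) → ∀ v ∈ nbrs,
      P ({ω | S (n + 1) ω = h n + v} ∩ prefixEvent S n h)
        = (1/4) * P (prefixEvent S n h))
    (hOrigin : ∀ (n : ℕ) (h : ℕ → ℤ × ℤ), h n = (0, 0) → ∀ v ∈ nbrs,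
      P ({ω | S (n + 1) ω = h n + v} ∩ prefixEvent S n h)
        = p v * P (prefixEvent S n h)) :
    Tendsto (fun n : ℕ => (n : ℝ) * (P {ω | S (2 * n) ω = (0, 0)}).toReal)
      atTop (𝓝 (1 / Real.pi)) := by
  let q : ℤ × ℤ → ℤ × ℤ → ℝ≥0∞ := fun x v => if x = (0, 0) then p v else 1 / 4
  have hq : ∀ x, ∑ v ∈ nbrs, q x v = 1 := by
    intro x
    by_cases hx : x = (0, 0)
    · simpa [q, hx] using hp
    · have hcard : nbrs.card = 4 := by decide
      simp only [q, if_neg hx, Finset.sum_const, hcard, nsmul_eq_mul]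
      exact ENNReal.mul_div_cancel (by norm_num) (by norm_num)
  have hstep : ∀ n x, ∀ v ∈ nbrs,
      P ({ω | S (n + 1) ω = x + v} ∩ {ω | S n ω = x}) = q x v * P {ω | S n ω = x} := by
    intro n x v hv
    refine measure_step_inter hmeas fun h hn => ?_
    by_cases hx : x = (0, 0)
    · simpa [q, hx] using hOrigin n h (hn.trans hx) v hv
    · simpa [q, hx] using hMarkov n h (by rwa [hn]) v hv
  have hpfin : ∀ v ∈ nbrs, p v ≠ ∞ := fun v hv =>
    ((ENNReal.sum_eq_top.not.1 (by rw [hp]; exact ENNReal.one_ne_top)) ⟨v, hv, ·⟩)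
  have hp' : ∑ v ∈ nbrs, (p v).toReal = 1 := by
    rw [← ENNReal.toReal_sum hpfin, hp, ENNReal.toReal_one]
  let m : ℕ → ℤ × ℤ → ℝ := fun n y => (P {ω | S n ω = y}).toReal
  have h0 : ∀ y, m 0 y = if y = (0, 0) then 1 else 0 := by
    intro y
    split_ifs with hy
    · have : P {ω | S 0 ω = y} = 1 := by
        have hae : {ω | S 0 ω = y} =ᵐ[P] Set.univ := by
          filter_upwards [hS0] with ω h
          exact propext ⟨fun _ => trivial, fun _ => h.trans hy.symm⟩
        rw [measure_congr hae, measure_univ]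
      simp [m, this]
    · have : P {ω | S 0 ω = y} = 0 := by
        refine measure_eq_zero_iff_ae_notMem.2 ?_
        filter_upwards [hS0] with ω h hω
        exact hy ((show S 0 ω = y from hω).symm.trans h)
      simp [m, this]
  have hm : ∀ n y, m (n + 1) y = 1 / 4 * ∑ v ∈ nbrs, m n (y - v)
      + originDefect (fun v => (p v).toReal) y * m n (0, 0) := by
    intro n y
    have hqfin : ∀ v ∈ nbrs, q (y - v) v * P {ω | S n ω = y - v} ≠ ∞ := by
      intro v hv
      refine ENNReal.mul_ne_top ?_ (measure_ne_top _ _)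
      simp only [q]
      split_ifs
      · exact hpfin v hv
      · simp
    have hterm : ∀ v, (q (y - v) v * P {ω | S n ω = y - v}).toReal = 1 / 4 * m n (y - v)
        + if y = v then ((p v).toReal - 1 / 4) * m n (0, 0) else 0 := by
      intro v
      by_cases hv : y = v
      · subst hv
        have : y - y = (0, 0) := sub_self y
        simp only [this, q, m, ENNReal.toReal_mul, if_true]
        ring
      · have : y - v ≠ (0, 0) := fun h => hv (sub_eq_zero.1 h)
        simp [this, q, m, hv]
    have hsum := measure_succ_eq_sum hmeas hq (hstep n) y
    simp only [m] at hterm ⊢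
    rw [hsum, ENNReal.toReal_sum hqfin, Finset.sum_congr rfl fun v _ => hterm v,
      Finset.sum_add_distrib, ← Finset.mul_sum, Finset.sum_ite_eq]
    simp only [originDefect, ite_mul, zero_mul]
  refine tendsto_mul_centralBinom_div_sq.congr fun n => ?_
  have h := rotation_average_eq hp' h0 hm (2 * n) 0 0
  rw [neg_zero, add_zero, sub_zero, lineWalkLaw_two_mul_zero] at h
  have h' : (P {ω | S (2 * n) ω = (0, 0)}).toReal = m (2 * n) (0, 0) := rfl
  rw [h']
  linear_combination -(n : ℝ) * h
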